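/- On flat ℝ³, let ψ_j be a smooth function with ψ_j(z) = Σ_i α_{ji} a¹_i(z/|z|) |z|^{−2} + O(|z|^{−3}) as |z| → ∞ (with corresponding decay of derivatives), where a¹_i are spherical harmonics of degree 1 on S², and Δψ_j is compactly supported up to O(|z|^{−5}) decay. Then lim_{R→∞} ∫_{B_R(0)} z_k Δψ_j dz = −√(12π) Σ_i α_{ji} ⟨a¹_i, Y_k⟩ where Y_k = √(3/(4π)) z_k/|z| is the normalized degree-1 spherical harmonic, i.e. the limit equals −√(12π) times the Y_k-coefficient of the leading angular part. -/

import Mathlib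

open Real MeasureTheory Filter Asymptotics Topology

/-- The Euclidean Laplacian `Δ f = Σ_i ∂²f/∂z_i²`. -/
noncomputable def lap {n : ℕ} (f : EuclideanSpace ℝ (Fin n) → ℝ)
    (z : EuclideanSpace ℝ (Fin n)) : ℝ :=
  ∑ i, fderiv ℝ (fun w => fderiv ℝ f w (EuclideanSpace.single i 1)) z
    (EuclideanSpace.single i 1)

abbrev E3 := EuclideanSpace ℝ (Fin 3)

theorem aux_cd (f : E3 → ℝ) (hf : ContDiff ℝ (⊤ : ℕ∞) f) (v : E3) :
    ContDiff ℝ (⊤ : ℕ∞) (fun w => fderiv ℝ f w v) :=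
  (hf.fderiv_right (m := (⊤ : ℕ∞)) (by simp)).clm_apply contDiff_const

theorem lap_cont (f : E3 → ℝ) (hf : ContDiff ℝ (⊤ : ℕ∞) f) : Continuous (lap f) := by
  unfold lap
  exact continuous_finsetSum _ fun i _ => (aux_cd _ (aux_cd f hf _) _).continuous

theorem ibp (f g : E3 → ℝ) (hf : ContDiff ℝ (⊤ : ℕ∞) f) (hg : ContDiff ℝ (⊤ : ℕ∞) g)
    (hgc : HasCompactSupport g) :
    ∫ z, g z * lap f z = ∫ z, f z * lap g z := by
  have key : ∀ i : Fin 3, Integrable (fun z => g z * fderiv ℝ (fun w => fderiv ℝ f w (EuclideanSpace.single i 1)) z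
        (EuclideanSpace.single i 1)) ∧ Integrable (fun z => f z * fderiv ℝ (fun w => fderiv ℝ g w (EuclideanSpace.single i 1)) z
        (EuclideanSpace.single i 1)) ∧ 
      ∫ z, g z * fderiv ℝ (fun w => fderiv ℝ f w (EuclideanSpace.single i 1)) z
        (EuclideanSpace.single i 1) = ∫ z, f z * fderiv ℝ (fun w => fderiv ℝ g w (EuclideanSpace.single i 1)) z
        (EuclideanSpace.single i 1) := by
    intro i
    set v : E3 := EuclideanSpace.single i 1
    have hf1 := aux_cd f hf v
    have hg1 := aux_cd g hg v
    have hf2 := aux_cd _ hf1 v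
    have hg2 := aux_cd _ hg1 v
    have cg1 : HasCompactSupport (fun w => fderiv ℝ g w v) := hgc.fderiv_apply (𝕜 := ℝ) v
    have cg2 : HasCompactSupport (fun w => fderiv ℝ (fun w => fderiv ℝ g w v) w v) := cg1.fderiv_apply (𝕜 := ℝ) v
    have i1 : Integrable (fun z => g z * fderiv ℝ (fun w => fderiv ℝ f w v) z v) :=
      (hg.continuous.mul hf2.continuous).integrable_of_hasCompactSupport hgc.mul_right
    have i2 : Integrable (fun z => f z * fderiv ℝ (fun w => fderiv ℝ g w v) z v) :=
      (hf.continuous.mul hg2.continuous).integrable_of_hasCompactSupport cg2.mul_left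
    have i3 : Integrable (fun z => fderiv ℝ f z v * fderiv ℝ g z v) :=
      (hf1.continuous.mul hg1.continuous).integrable_of_hasCompactSupport cg1.mul_left
    have i4 : Integrable (fun z => g z * fderiv ℝ f z v) :=
      (hg.continuous.mul hf1.continuous).integrable_of_hasCompactSupport hgc.mul_right
    have i5 : Integrable (fun z => f z * fderiv ℝ g z v) :=
      (hf.continuous.mul hg1.continuous).integrable_of_hasCompactSupport cg1.mul_left
    refine ⟨i1, i2, ?_⟩
    rw [integral_mul_fderiv_eq_neg_fderiv_mul_of_integrable
      (by simpa only [mul_comm] using i3) i1 i4 (fun x _ => hg.differentiable (by simp) x)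
      (fun x _ => hf1.differentiable (by simp) x),
      integral_mul_fderiv_eq_neg_fderiv_mul_of_integrable
      i3 i2 i5 (fun x _ => hf.differentiable (by simp) x)
      (fun x _ => hg1.differentiable (by simp) x)]
    simp only [mul_comm]
  unfold lap
  simp only [Finset.mul_sum]
  rw [integral_finsetSum _ fun i _ => (key i).1, integral_finsetSum _ fun i _ => (key i).2.1]
  exact Finset.sum_congr rfl fun i _ => (key i).2.2

theorem lap_radial (h : ℝ → ℝ) (hh : ContDiff ℝ (⊤ : ℕ∞) h) (k : Fin 3) (z : E3) :
    lap (fun w : E3 => w k * h (‖w‖ ^ 2)) z =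
      z k * (10 * deriv h (‖z‖ ^ 2) + 4 * ‖z‖ ^ 2 * deriv (deriv h) (‖z‖ ^ 2)) := by
  have hh1 : ContDiff ℝ (⊤ : ℕ∞) (deriv h) := ((contDiff_succ_iff_deriv (n := (⊤ : ℕ∞))).1 (by simpa using hh)).2.2
  have hn : ∀ w : E3, HasFDerivAt (fun w : E3 => ‖w‖ ^ 2) (2 • (innerSL ℝ w)) w := fun w =>
    (hasStrictFDerivAt_norm_sq w).hasFDerivAt
  have hc : ∀ (j : Fin 3) (w : E3), HasFDerivAt (fun w : E3 => w j) (EuclideanSpace.proj j : E3 →L[ℝ] ℝ) w :=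
    fun j w => (EuclideanSpace.proj j : E3 →L[ℝ] ℝ).hasFDerivAt
  have hd : ∀ w : E3, HasFDerivAt (fun w : E3 => h (‖w‖ ^ 2)) (deriv h (‖w‖ ^ 2) • (2 • (innerSL ℝ w))) w :=
    fun w => ((hh.differentiable (by simp) _).hasDerivAt).comp_hasFDerivAt w (hn w)
  have hd1 : ∀ w : E3, HasFDerivAt (fun w : E3 => deriv h (‖w‖ ^ 2)) (deriv (deriv h) (‖w‖ ^ 2) • (2 • (innerSL ℝ w))) w :=
    fun w => ((hh1.differentiable (by simp) _).hasDerivAt).comp_hasFDerivAt w (hn w)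
  have e1 : ∀ i : Fin 3, (fun w : E3 => fderiv ℝ (fun w : E3 => w k * h (‖w‖ ^ 2)) w (EuclideanSpace.single i 1))
      = fun w : E3 => (w k * w i) * (2 * deriv h (‖w‖ ^ 2)) + (if k = i then 1 else 0) * h (‖w‖ ^ 2) := by
    intro i
    ext w
    rw [((hc k w).fun_mul (hd w)).fderiv]
    by_cases hki : k = i
    · simp [EuclideanSpace.inner_single_right, hki]
      ring
    · simp [EuclideanSpace.inner_single_right, hki]
      ring
  have e2 : ∀ i : Fin 3, fderiv ℝ (fun w : E3 => (w k * w i) * (2 * deriv h (‖w‖ ^ 2)) + (if k = i then 1 else 0) * h (‖w‖ ^ 2)) z (EuclideanSpace.single i 1) =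
     (z k * z i) * (4 * deriv (deriv h) (‖z‖ ^ 2) * z i) + (z k + (if k = i then z i else 0)) * (2 * deriv h (‖z‖ ^ 2)) + (if k = i then 2 * deriv h (‖z‖ ^ 2) * z i else 0) := by
    intro i
    rw [((((hc k z).fun_mul (hc i z)).fun_mul ((hd1 z).const_mul 2)).fun_add ((hd z).const_mul (if k = i then 1 else 0))).fderiv]
    by_cases hki : k = i
    · simp [EuclideanSpace.inner_single_right, hki]
      ring
    · simp [EuclideanSpace.inner_single_right, hki]
      ring
  unfold lap
  simp only [e1, e2]
  have hs : ‖z‖ ^ 2 = z 0 ^ 2 + z 1 ^ 2 + z 2 ^ 2 := by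
    rw [EuclideanSpace.norm_sq_eq]; simp [Fin.sum_univ_three]
  generalize deriv h (‖z‖ ^ 2) = A
  generalize deriv (deriv h) (‖z‖ ^ 2) = B
  rw [hs]
  simp only [Fin.sum_univ_three]
  fin_cases k <;> simp <;> ring

theorem angular (q : ℝ → ℝ) (k i : Fin 3) (hik : i ≠ k) :
    ∫ y : E3, y i * y k * q ‖y‖ = 0 := by
  let e : E3 ≃ₗᵢ[ℝ] E3 := LinearIsometryEquiv.piLpCongrRight 2
    (fun j => if j = i then LinearIsometryEquiv.neg ℝ else LinearIsometryEquiv.refl ℝ ℝ)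
  have h := e.measurePreserving.integral_comp' (f := e.toMeasurableEquiv) (g := fun y : E3 => y i * y k * q ‖y‖)
  have : ∀ y : E3, (e y) i * (e y) k * q ‖e y‖ = - (y i * y k * q ‖y‖) := by
    intro y
    rw [LinearIsometryEquiv.norm_map]
    simp [e, LinearIsometryEquiv.piLpCongrRight_apply, hik.symm]
  simp only [LinearIsometryEquiv.coe_toMeasurableEquiv, this, integral_neg] at h
  linarith

theorem angular2 (q : ℝ → ℝ) (k i : Fin 3) :
    ∫ y : E3, y i * y i * q ‖y‖ = ∫ y : E3, y k * y k * q ‖y‖ := by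
  let e : E3 ≃ₗᵢ[ℝ] E3 := LinearIsometryEquiv.piLpCongrLeft 2 ℝ ℝ (Equiv.swap i k)
  have h := e.measurePreserving.integral_comp' (f := e.toMeasurableEquiv) (g := fun y : E3 => y i * y i * q ‖y‖)
  have : ∀ y : E3, (e y) i * (e y) i * q ‖e y‖ = (y k * y k * q ‖y‖) := by
    intro y
    rw [LinearIsometryEquiv.norm_map]
    simp [e, LinearIsometryEquiv.piLpCongrLeft_apply, Equiv.piCongrLeft']
  simp only [LinearIsometryEquiv.coe_toMeasurableEquiv, this] at h
  linarith

theorem exists_cutoff : ∃ h : ℝ → ℝ, ContDiff ℝ (⊤ : ℕ∞) h ∧ ContDiff ℝ (⊤ : ℕ∞) (deriv h) ∧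
    Continuous (deriv (deriv h)) ∧
    (∀ s ≤ 1, h s = 1) ∧ (∀ s, 2 ≤ s → h s = 0) ∧ (∀ s, |h s| ≤ 1) ∧
    (∀ s, s < 1 ∨ 2 < s → deriv h s = 0 ∧ deriv (deriv h) s = 0) := by
  have hh : ContDiff ℝ (⊤ : ℕ∞) (fun s : ℝ => Real.smoothTransition (2 - s)) :=
    Real.smoothTransition.contDiff.comp (contDiff_const.sub contDiff_id)
  have hh1 : ContDiff ℝ (⊤ : ℕ∞) (deriv (fun s : ℝ => Real.smoothTransition (2 - s))) :=
    ((contDiff_succ_iff_deriv (n := (⊤ : ℕ∞))).1 (by simpa using hh)).2.2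
  have o1 : ∀ s : ℝ, s ≤ 1 → Real.smoothTransition (2 - s) = 1 := fun s hs =>
    Real.smoothTransition.one_of_one_le (by linarith)
  have o2 : ∀ s : ℝ, 2 ≤ s → Real.smoothTransition (2 - s) = 0 := fun s hs =>
    Real.smoothTransition.zero_of_nonpos (by linarith)
  refine ⟨_, hh, hh1, hh1.continuous_deriv (by simp), o1, o2, fun s => ?_, fun s hs => ?_⟩
  · rw [abs_of_nonneg (Real.smoothTransition.nonneg _)]
    exact Real.smoothTransition.le_one _
  · have : ∃ c : ℝ, (fun s : ℝ => Real.smoothTransition (2 - s)) =ᶠ[𝓝 s] fun _ => c := by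
      rcases hs with hs | hs
      · exact ⟨1, by filter_upwards [gt_mem_nhds hs] with x hx using o1 x hx.le⟩
      · exact ⟨0, by filter_upwards [lt_mem_nhds hs] with x hx using o2 x hx.le⟩
    obtain ⟨c, hc⟩ := this
    have h1 := hc.deriv
    have h2 := h1.deriv
    exact ⟨by simpa using h1.eq_of_nhds, by simpa using h2.eq_of_nhds⟩

theorem compact_of_zero (f : E3 → ℝ) (r : ℝ) (hf : ∀ z, r < ‖z‖ → f z = 0) : HasCompactSupport f := by
  refine HasCompactSupport.intro (isCompact_closedBall (0 : E3) r) fun z hz => hf z ?_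
  simpa using hz

theorem radial_int (h : ℝ → ℝ) (hh : ContDiff ℝ (⊤ : ℕ∞) h) (hh1 : ContDiff ℝ (⊤ : ℕ∞) (deriv h))
    (hc2 : Continuous (deriv (deriv h)))
    (h1 : ∀ s ≤ 1, h s = 1) (h2 : ∀ s, 2 ≤ s → h s = 0)
    (hz : ∀ s, s < 1 ∨ 2 < s → deriv h s = 0 ∧ deriv (deriv h) s = 0) (q : ℝ → ℝ)
    (hq : ∀ s, q s = 10 * deriv h s + 4 * s * deriv (deriv h) s) (k i : Fin 3) :
    Integrable (fun y : E3 => y i * y k * (q (‖y‖ ^ 2) / ‖y‖ ^ 3)) ∧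
    ∫ y : E3, y i * y k * (q (‖y‖ ^ 2) / ‖y‖ ^ 3) = if i = k then - (4 * π) else 0 := by
  have hqc : Continuous q := by
    rw [show q = fun s => 10 * deriv h s + 4 * s * deriv (deriv h) s from funext hq]
    have := hh1.continuous
    fun_prop
  have hqz : ∀ s, s < 1 ∨ 2 < s → q s = 0 := fun s hs => by
    rw [hq, (hz s hs).1, (hz s hs).2]; ring
  have hint : ∀ i k : Fin 3, Integrable (fun y : E3 => y i * y k * (q (‖y‖ ^ 2) / ‖y‖ ^ 3)) := by
    intro i k
    have I0 : Integrable (fun y : E3 => y i * y k * q (‖y‖ ^ 2)) := by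
      refine Continuous.integrable_of_hasCompactSupport (by fun_prop) (compact_of_zero _ 2 fun z hz => ?_)
      rw [hqz _ (Or.inr (by nlinarith)), mul_zero]
    refine I0.mono ?_ (ae_of_all _ fun y => ?_)
    · refine Measurable.aestronglyMeasurable ?_
      have := hqc.measurable
      fun_prop
    · rw [← mul_div_assoc, norm_div]
      by_cases hy : ‖y‖ < 1
      · rw [hqz _ (Or.inl (by nlinarith [norm_nonneg y]))]; simp
      · refine div_le_self (norm_nonneg _) ?_
        rw [norm_pow, norm_norm]
        exact one_le_pow₀ (not_lt.1 hy)
  refine ⟨hint i k, ?_⟩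
  split_ifs with hik
  swap
  · exact angular (fun r => q (r ^ 2) / r ^ 3) k i hik
  subst hik
  have hsum : ∫ y : E3, ‖y‖ ^ 2 * (q (‖y‖ ^ 2) / ‖y‖ ^ 3) =
      3 * ∫ y : E3, y i * y i * (q (‖y‖ ^ 2) / ‖y‖ ^ 3) := by
    have : ∀ y : E3, ‖y‖ ^ 2 * (q (‖y‖ ^ 2) / ‖y‖ ^ 3) = ∑ j : Fin 3, y j * y j * (q (‖y‖ ^ 2) / ‖y‖ ^ 3) := by
      intro y
      rw [← Finset.sum_mul]
      congr 1
      rw [EuclideanSpace.norm_sq_eq]; simp [pow_two]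
    simp_rw [this]
    rw [integral_finsetSum _ fun j _ => hint j j,
      Finset.sum_congr rfl fun j _ => angular2 (fun r => q (r ^ 2) / r ^ 3) i j]
    simp
  have hrad := integral_fun_norm_addHaar (volume : Measure E3) (fun r => r ^ 2 * (q (r ^ 2) / r ^ 3))
  have h1d : ∫ r in Set.Ioi (0 : ℝ), r * q (r ^ 2) = -3 := by
    have hd : ∀ r : ℝ, HasDerivAt (fun r => 2 * r ^ 2 * deriv h (r ^ 2) + 3 * h (r ^ 2)) (r * q (r ^ 2)) r := by
      intro r
      have a0 : HasDerivAt (fun r : ℝ => r ^ 2) (2 * r) r := by simpa using hasDerivAt_pow 2 r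
      have a1 : HasDerivAt (fun r : ℝ => h (r ^ 2)) (deriv h (r ^ 2) * (2 * r)) r :=
        (hh.differentiable (by simp) _).hasDerivAt.comp r a0
      have a2 : HasDerivAt (fun r : ℝ => deriv h (r ^ 2)) (deriv (deriv h) (r ^ 2) * (2 * r)) r :=
        (hh1.differentiable (by simp) _).hasDerivAt.comp r a0
      refine (((a0.const_mul 2).fun_mul a2).fun_add (a1.const_mul 3)).congr_deriv ?_
      rw [hq]; ring
    have hi : Integrable (fun r : ℝ => r * q (r ^ 2)) := by
      refine Continuous.integrable_of_hasCompactSupport (by fun_prop)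
        (HasCompactSupport.intro (isCompact_closedBall (0 : ℝ) 2) fun r hr => ?_)
      have hr : 2 < |r| := by simpa using hr
      rw [hqz _ (Or.inr (by rw [← sq_abs]; nlinarith)), mul_zero]
    have ht : Tendsto (fun r => 2 * r ^ 2 * deriv h (r ^ 2) + 3 * h (r ^ 2)) atTop (𝓝 0) := by
      refine tendsto_const_nhds.congr' ?_
      filter_upwards [eventually_gt_atTop 2] with r hr
      rw [(hz _ (Or.inr (by nlinarith))).1, h2 _ (by nlinarith)]; ring
    rw [integral_Ioi_of_hasDerivAt_of_tendsto' (fun x _ => hd x) hi.integrableOn ht]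
    simp [h1 0 (by norm_num)]
  have h1d' : ∫ r in Set.Ioi (0 : ℝ), r ^ (Module.finrank ℝ E3 - 1) • (r ^ 2 * (q (r ^ 2) / r ^ 3)) = -3 := by
    rw [← h1d]
    refine setIntegral_congr_fun measurableSet_Ioi fun r hr => ?_
    have hr : (0 : ℝ) < r := hr
    simp
    field_simp
  rw [h1d', hsum] at hrad
  have hv : (volume : Measure E3).real (Metric.ball 0 1) = π * 4 / 3 := by
    rw [Measure.real, EuclideanSpace.volume_ball_fin_three]
    simp
    positivity
  rw [hv] at hrad
  simp at hrad
  linarith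

theorem int_lap (ψ : E3 → ℝ) (k : Fin 3)
    (hsmooth : ContDiff ℝ (⊤ : ℕ∞) ψ)
    (hlap : (fun z : E3 => lap ψ z) =O[Bornology.cobounded E3] fun z => ‖z‖ ^ (-5 : ℤ)) :
    Integrable (fun z : E3 => z k * lap ψ z) := by
  have hc : Continuous (fun z : E3 => z k * lap ψ z) := by
    have := lap_cont ψ hsmooth
    fun_prop
  rw [Metric.cobounded_eq_cocompact] at hlap
  have hI : Integrable (fun z : E3 => (1 + ‖z‖) ^ (-4 : ℝ)) := integrable_one_add_norm (by simp; norm_num)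
  refine hc.locallyIntegrable.integrable_of_isBigO_cocompact (g := fun z : E3 => (1 + ‖z‖) ^ (-4 : ℝ)) ?_
    (hI.integrableAtFilter _)
  have a1 : (fun z : E3 => z k) =O[cocompact E3] fun z => ‖z‖ :=
    IsBigO.of_bound 1 (Eventually.of_forall fun z => by simpa using PiLp.norm_apply_le z k)
  refine (a1.mul hlap).trans (IsBigO.of_bound 16 ?_)
  rw [← Metric.cobounded_eq_cocompact]
  filter_upwards [tendsto_norm_cobounded_atTop.eventually_ge_atTop 1] with z hz
  have h0 : 0 < ‖z‖ := by linarith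
  rw [show (-4 : ℝ) = ((-4 : ℤ) : ℝ) by norm_num, Real.rpow_intCast]
  rw [Real.norm_of_nonneg (by positivity), Real.norm_of_nonneg (by positivity)]
  rw [show (-4 : ℤ) = -((4 : ℕ) : ℤ) by norm_num, show (-5 : ℤ) = -((5 : ℕ) : ℤ) by norm_num, zpow_neg, zpow_neg, zpow_natCast, zpow_natCast]
  rw [show ‖z‖ * (‖z‖ ^ 5)⁻¹ = 1 / ‖z‖ ^ 4 by field_simp, ← div_eq_mul_inv, div_le_div_iff₀ (by positivity) (by positivity)]
  have : (1 + ‖z‖) ^ 4 ≤ (2 * ‖z‖) ^ 4 := by gcongr; linarith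
  nlinarith

theorem cutoff_identity (ψ : E3 → ℝ) (k : Fin 3) (hsmooth : ContDiff ℝ (⊤ : ℕ∞) ψ)
    (h : ℝ → ℝ) (hh : ContDiff ℝ (⊤ : ℕ∞) h) (h2 : ∀ s, 2 ≤ s → h s = 0) (q : ℝ → ℝ)
    (hq : ∀ s, q s = 10 * deriv h s + 4 * s * deriv (deriv h) s) (R : ℝ) (hR : 0 < R) :
    ∫ z : E3, z k * h ((R ^ 2)⁻¹ * ‖z‖ ^ 2) * lap ψ z =
      ∫ y : E3, R ^ 2 * ψ (R • y) * (y k * q (‖y‖ ^ 2)) := by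
  set ε := (R ^ 2)⁻¹ with hε
  have hg : ContDiff ℝ (⊤ : ℕ∞) (fun s => h (ε * s)) := hh.comp (contDiff_const.mul contDiff_id)
  have hgc : ContDiff ℝ (⊤ : ℕ∞) (fun z : E3 => z k * h (ε * ‖z‖ ^ 2)) := by
    refine ContDiff.mul ?_ (hg.comp (contDiff_norm_sq ℝ))
    exact (EuclideanSpace.proj k : E3 →L[ℝ] ℝ).contDiff
  have hsupp : HasCompactSupport (fun z : E3 => z k * h (ε * ‖z‖ ^ 2)) := by
    refine compact_of_zero _ (2 * R) fun z hz => ?_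
    rw [h2, mul_zero]
    rw [hε, ← div_eq_inv_mul, le_div_iff₀ (by positivity)]
    nlinarith
  rw [ibp ψ _ hsmooth hgc hsupp]
  have d1 : deriv (fun s => h (ε * s)) = fun s => ε * deriv h (ε * s) := by
    ext s; rw [deriv_comp_mul_left]; simp
  have d2 : deriv (fun s => ε * deriv h (ε * s)) = fun s => ε * (ε * deriv (deriv h) (ε * s)) := by
    ext s; rw [deriv_const_mul_field, deriv_comp_mul_left]; simp
  have hl : ∀ z : E3, lap (fun w : E3 => w k * h (ε * ‖w‖ ^ 2)) z = ε * z k * q (ε * ‖z‖ ^ 2) := by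
    intro z
    rw [lap_radial (fun s => h (ε * s)) hg k z, d1, d2, hq]
    ring
  simp_rw [hl]
  have := Measure.integral_comp_smul_of_nonneg (volume : Measure E3)
    (fun z : E3 => ψ z * (ε * z k * q (ε * ‖z‖ ^ 2))) R (hR := hR.le)
  rw [eq_comm, inv_smul_eq_iff₀ (by positivity), ← integral_smul] at this
  rw [this]
  congr 1
  ext y
  have e1 : ε * ‖R • y‖ ^ 2 = ‖y‖ ^ 2 := by
    rw [norm_smul, Real.norm_of_nonneg hR.le, hε]; field_simp
  rw [e1]
  simp [hε]
  field_simp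

theorem limit_scaled (ψ : E3 → ℝ) (α : Fin 3 → ℝ) (c : ℝ)
    (hasymp : (fun z : E3 => ψ z - ∑ i, α i * (c * z i / ‖z‖) * ‖z‖ ^ (-2 : ℤ))
      =O[Bornology.cobounded E3] fun z => ‖z‖ ^ (-3 : ℤ)) :
    (∀ y : E3, y ≠ 0 → Tendsto (fun R : ℝ => R ^ 2 * ψ (R • y)) atTop
      (𝓝 (∑ i, α i * c * y i / ‖y‖ ^ 3))) ∧
    ∃ C, ∀ᶠ R : ℝ in atTop, ∀ y : E3, 1 ≤ ‖y‖ → |R ^ 2 * ψ (R • y)| ≤ C := by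
  obtain ⟨C, hC⟩ := hasymp.bound
  rw [← comap_norm_atTop, eventually_comap, eventually_atTop] at hC
  obtain ⟨r0, hr0⟩ := hC
  have key : ∀ (R : ℝ) (y : E3), 0 < R → 0 < ‖y‖ → r0 ≤ R * ‖y‖ →
      |R ^ 2 * ψ (R • y) - ∑ i, α i * c * y i / ‖y‖ ^ 3| ≤ C * (R⁻¹ * (‖y‖ ^ 3)⁻¹) := by
    intro R y hR hy hle
    have hn : ‖R • y‖ = R * ‖y‖ := by rw [norm_smul, Real.norm_of_nonneg hR.le]
    have := hr0 _ hle (R • y) hn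
    have e1 : R ^ 2 * ψ (R • y) - ∑ i, α i * c * y i / ‖y‖ ^ 3 = R ^ 2 *
       (ψ (R • y) - ∑ i, α i * (c * (R • y) i / ‖R • y‖) * ‖R • y‖ ^ (-2 : ℤ)) := by
      rw [mul_sub, Finset.mul_sum]
      congr 1
      refine Finset.sum_congr rfl fun i _ => ?_
      rw [hn, show (-2 : ℤ) = -((2 : ℕ) : ℤ) by norm_num, zpow_neg, zpow_natCast]
      simp
      field_simp
    rw [e1, abs_mul, abs_of_nonneg (by positivity : 0 ≤ R ^ 2)]
    refine (mul_le_mul_of_nonneg_left this (by positivity)).trans (le_of_eq ?_)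
    rw [hn, Real.norm_of_nonneg (by positivity), show (-3 : ℤ) = -((3 : ℕ) : ℤ) by norm_num, zpow_neg, zpow_natCast]
    field_simp
  constructor
  · intro y hy
    have hy : 0 < ‖y‖ := norm_pos_iff.2 hy
    rw [tendsto_iff_norm_sub_tendsto_zero]
    have ht : Tendsto (fun R : ℝ => C * (R⁻¹ * (‖y‖ ^ 3)⁻¹)) atTop (𝓝 0) := by
      simpa using (tendsto_inv_atTop_zero.mul_const ((‖y‖ ^ 3)⁻¹)).const_mul C
    refine squeeze_zero' (Eventually.of_forall fun _ => norm_nonneg _) ?_ ht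
    filter_upwards [eventually_gt_atTop 0, eventually_ge_atTop (r0 / ‖y‖)] with R h1 h2
    exact key R y h1 hy ((div_le_iff₀ hy).1 h2)
  · refine ⟨|C| + ∑ i, |α i * c|, ?_⟩
    filter_upwards [eventually_ge_atTop 1, eventually_ge_atTop r0] with R h1 h2 y hy
    have hk := key R y (by linarith) (by linarith) (by nlinarith [abs_nonneg r0])
    have a1 : C * (R⁻¹ * (‖y‖ ^ 3)⁻¹) ≤ |C| := by
      have b1 : R⁻¹ ≤ 1 := inv_le_one_of_one_le₀ h1
      have b2 : (‖y‖ ^ 3)⁻¹ ≤ 1 := inv_le_one_of_one_le₀ (one_le_pow₀ hy)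
      have b3 : R⁻¹ * (‖y‖ ^ 3)⁻¹ ≤ 1 := mul_le_one₀ b1 (by positivity) b2
      have b4 : 0 ≤ R⁻¹ * (‖y‖ ^ 3)⁻¹ := by positivity
      calc _ ≤ |C| * (R⁻¹ * (‖y‖ ^ 3)⁻¹) := mul_le_mul_of_nonneg_right (le_abs_self C) b4
        _ ≤ |C| * 1 := mul_le_mul_of_nonneg_left b3 (abs_nonneg C)
        _ = |C| := mul_one _
    have a2 : |∑ i, α i * c * y i / ‖y‖ ^ 3| ≤ ∑ i, |α i * c| := by
      refine (Finset.abs_sum_le_sum_abs _ _).trans (Finset.sum_le_sum fun i _ => ?_)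
      rw [mul_div_assoc, abs_mul]
      refine mul_le_of_le_one_right (abs_nonneg _) ?_
      rw [abs_div, abs_of_nonneg (by positivity : 0 ≤ ‖y‖ ^ 3)]
      refine div_le_one_of_le₀ ?_ (by positivity)
      have := PiLp.norm_apply_le y i
      rw [Real.norm_eq_abs] at this
      exact this.trans (le_self_pow₀ hy (by norm_num))
    have := abs_sub_abs_le_abs_sub (R ^ 2 * ψ (R • y)) (∑ i, α i * c * y i / ‖y‖ ^ 3)
    linarith

/-- On `ℝ³`, if `ψ(z) = Σ_i α_i Y_i(z/|z|) |z|⁻² + O(|z|⁻³)` with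
`Y_i(ω) = √(3/(4π)) ω_i` the normalized degree-1 spherical harmonics, with
corresponding decay of the gradient and `Δψ = O(|z|⁻⁵)`, then
`lim_{R→∞} ∫_{B_R} z_k Δψ dz = -√(12π) α_k`, i.e. `-√(12π)` times the
`Y_k`-coefficient of the leading angular part. -/
theorem stmt8 (ψ : EuclideanSpace ℝ (Fin 3) → ℝ) (α : Fin 3 → ℝ) (k : Fin 3)
    (hsmooth : ContDiff ℝ (⊤ : ℕ∞) ψ)
    (hasymp : (fun z : EuclideanSpace ℝ (Fin 3) =>
        ψ z - ∑ i, α i * (Real.sqrt (3 / (4 * π)) * z i / ‖z‖) * ‖z‖ ^ (-2 : ℤ))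
      =O[Bornology.cobounded (EuclideanSpace ℝ (Fin 3))]
        fun z => ‖z‖ ^ (-3 : ℤ))
    (hgrad : (fun z : EuclideanSpace ℝ (Fin 3) => ‖fderiv ℝ ψ z‖)
      =O[Bornology.cobounded (EuclideanSpace ℝ (Fin 3))]
        fun z => ‖z‖ ^ (-3 : ℤ))
    (hlap : (fun z : EuclideanSpace ℝ (Fin 3) => lap ψ z)
      =O[Bornology.cobounded (EuclideanSpace ℝ (Fin 3))]
        fun z => ‖z‖ ^ (-5 : ℤ)) :
    Tendsto (fun R : ℝ =>
        ∫ z in Metric.ball (0 : EuclideanSpace ℝ (Fin 3)) R, z k * lap ψ z)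
      atTop (nhds (-Real.sqrt (12 * π) * α k)) := by
  obtain ⟨h, hh, hh1, hc2, h1, h2, hb, hz⟩ := exists_cutoff
  obtain ⟨q, hq⟩ : ∃ q : ℝ → ℝ, ∀ s, q s = 10 * deriv h s + 4 * s * deriv (deriv h) s := ⟨_, fun _ => rfl⟩
  have hqc : Continuous q := by
    rw [show q = fun s => 10 * deriv h s + 4 * s * deriv (deriv h) s from funext hq]
    have := hh1.continuous
    fun_prop
  have hqz : ∀ s, s < 1 ∨ 2 < s → q s = 0 := fun s hs => by
    rw [hq, (hz s hs).1, (hz s hs).2]; ring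
  have hI := int_lap ψ k hsmooth hlap
  have T1 := (aecover_ball (μ := volume) (x := (0 : E3)) (tendsto_id (α := ℝ) (x := atTop))).integral_tendsto_of_countably_generated hI
  have T2 : Tendsto (fun R : ℝ => ∫ z : E3, z k * h ((R ^ 2)⁻¹ * ‖z‖ ^ 2) * lap ψ z) atTop
      (𝓝 (∫ z : E3, z k * lap ψ z)) := by
    have hlc := lap_cont ψ hsmooth
    have hhc := hh.continuous
    refine tendsto_integral_filter_of_dominated_convergence (fun z => ‖z k * lap ψ z‖)
      (Eventually.of_forall fun R => Continuous.aestronglyMeasurable (by fun_prop))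
      (Eventually.of_forall fun R => ae_of_all _ fun z => ?_) hI.norm (ae_of_all _ fun z => ?_)
    · rw [mul_right_comm, norm_mul]
      exact mul_le_of_le_one_right (norm_nonneg _) (hb _)
    · refine tendsto_const_nhds.congr' ?_
      filter_upwards [eventually_ge_atTop 1, eventually_ge_atTop ‖z‖] with R hR hRz
      rw [h1, mul_one]
      rw [← div_eq_inv_mul]
      refine div_le_one_of_le₀ ?_ (by positivity)
      gcongr
  obtain ⟨L1, C, L2⟩ := limit_scaled ψ α _ hasymp
  set c := Real.sqrt (3 / (4 * π)) with hcdef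
  have T3 : Tendsto (fun R : ℝ => ∫ y : E3, R ^ 2 * ψ (R • y) * (y k * q (‖y‖ ^ 2))) atTop
      (𝓝 (∫ y : E3, (∑ i, α i * c * y i / ‖y‖ ^ 3) * (y k * q (‖y‖ ^ 2)))) := by
    have hψ := hsmooth.continuous
    have I0 : Integrable (fun y : E3 => y k * q (‖y‖ ^ 2)) := by
      refine Continuous.integrable_of_hasCompactSupport (by fun_prop) (compact_of_zero _ 2 fun z hz => ?_)
      rw [hqz _ (Or.inr (by nlinarith)), mul_zero]
    refine tendsto_integral_filter_of_dominated_convergence (fun y => C * ‖y k * q (‖y‖ ^ 2)‖)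
      (Eventually.of_forall fun R => Continuous.aestronglyMeasurable (by fun_prop))
      ?_ (I0.norm.const_mul C) (ae_of_all _ fun y => ?_)
    · filter_upwards [L2] with R hR
      refine ae_of_all _ fun y => ?_
      by_cases hy : ‖y‖ < 1
      · rw [hqz _ (Or.inl (by nlinarith [norm_nonneg y]))]; simp
      · rw [norm_mul]
        exact mul_le_mul_of_nonneg_right (hR y (not_lt.1 hy)) (norm_nonneg _)
    · by_cases hy : y = 0
      · simp [hy]
      · exact (L1 y hy).mul_const _
  have T3' := T3.congr' (f₂ := fun R : ℝ => ∫ z : E3, z k * h ((R ^ 2)⁻¹ * ‖z‖ ^ 2) * lap ψ z) (by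
    filter_upwards [eventually_gt_atTop 0] with R hR
    exact (cutoff_identity ψ k hsmooth h hh h2 q hq R hR).symm)
  have hL := tendsto_nhds_unique T2 T3'
  have hval : ∫ y : E3, (∑ i, α i * c * y i / ‖y‖ ^ 3) * (y k * q (‖y‖ ^ 2)) = -Real.sqrt (12 * π) * α k := by
    have hr := radial_int h hh hh1 hc2 h1 h2 hz q hq k
    have e : ∀ y : E3, (∑ i, α i * c * y i / ‖y‖ ^ 3) * (y k * q (‖y‖ ^ 2)) =
        ∑ i, α i * c * (y i * y k * (q (‖y‖ ^ 2) / ‖y‖ ^ 3)) := by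
      intro y
      rw [Finset.sum_mul]
      refine Finset.sum_congr rfl fun i _ => ?_
      ring
    simp_rw [e]
    rw [integral_finsetSum _ fun i _ => (hr i).1.const_mul _]
    simp_rw [integral_const_mul, (hr _).2]
    simp only [mul_ite, mul_zero, Finset.sum_ite_eq', Finset.mem_univ, if_true]
    have hs : Real.sqrt (12 * π) = 4 * π * c := by
      have h3 : c * c = 3 / (4 * π) := Real.mul_self_sqrt (by positivity)
      have h4 : 12 * π = (4 * π * c) ^ 2 := by
        have : (4 * π * c) ^ 2 = 16 * π ^ 2 * (c * c) := by ring
        rw [this, h3]; field_simp; norm_num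
      rw [h4, Real.sqrt_sq (by positivity)]
    rw [hs]; ring
  rw [hL, hval] at T1
  exact T1
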